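/- Assume n = 2, f is smooth with support in the closed unit disc, and g = ℳ_S(f). Then for every x ∈ B, f(x) = (1/(2π)) ∫_S ∫_0^2 [ ∂_r ( r · ∂_r g(y,r) ) ] · ln| r² − |x−y|² | dr dσ(y); the r-integral converges absolutely since the logarithmic singularity at r = |x−y| is integrable. -/

import Mathlib

open MeasureTheory Function

noncomputable section

/-- The constant `c_n`. -/
def cnConst (n : ℕ) : ℝ :=
  if Even n then (-1 : ℝ) ^ ((n - 2) / 2) / (2 * Real.pi) ^ (n / 2)
  else (-1 : ℝ) ^ ((n - 3) / 2) / (2 * (2 * Real.pi) ^ ((n - 1) / 2))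

/-- The operator `v ↦ (1/s) v'(s)` on complex-valued functions. -/
def invDerivC (v : ℝ → ℂ) : ℝ → ℂ := fun s => deriv v s / (s : ℂ)

/-- The operator `v ↦ (1/s) v'(s)` on real-valued functions. -/
def invDerivR (v : ℝ → ℝ) : ℝ → ℝ := fun s => deriv v s / s

/-- The free-space outgoing Green's function `G(s,λ)` of the Helmholtz equation. -/
def GreenG (n : ℕ) (s lam : ℝ) : ℂ :=
  if Even n then
    (cnConst n : ℂ) *
      (invDerivC^[(n - 2) / 2]
        (fun s' => ∫ t in Set.Ioi s',
          Complex.exp (Complex.I * lam * t) / (Real.sqrt (t ^ 2 - s' ^ 2) : ℂ)) s)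
  else
    (cnConst n : ℂ) *
      (invDerivC^[(n - 3) / 2] (fun s' => Complex.exp (Complex.I * lam * s') / (s' : ℂ)) s)

/-- The transform `W` on real-valued functions. -/
def Wtr (n : ℕ) (v : ℝ → ℝ) (s : ℝ) : ℝ :=
  if Even n then
    cnConst n * (invDerivR^[(n - 2) / 2]
      (fun s' => ∫ t in Set.Ioi s', v t / Real.sqrt (t ^ 2 - s' ^ 2)) s)
  else
    cnConst n * (invDerivR^[(n - 3) / 2] (fun s' => v s' / s') s)

/-- The transform `W` on complex-valued functions. -/
def WtrC (n : ℕ) (v : ℝ → ℂ) (s : ℝ) : ℂ :=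
  if Even n then
    (cnConst n : ℂ) * (invDerivC^[(n - 2) / 2]
      (fun s' => ∫ t in Set.Ioi s', v t / (Real.sqrt (t ^ 2 - s' ^ 2) : ℂ)) s)
  else
    (cnConst n : ℂ) * (invDerivC^[(n - 3) / 2] (fun s' => v s' / (s' : ℂ)) s)

abbrev Esp (n : ℕ) := EuclideanSpace ℝ (Fin n)

/-- The unit sphere centered at the origin. -/
def unitSphere (n : ℕ) : Set (Esp n) := Metric.sphere 0 1

/-- The surface measure: `(n-1)`-dimensional Hausdorff measure. -/
def sphMeasure (n : ℕ) : Measure (Esp n) := μH[(n : ℝ) - 1]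

/-- The Laplacian, as the sum of second directional derivatives along coordinate axes. -/
def lapl {n : ℕ} (f : Esp n → ℝ) (x : Esp n) : ℝ :=
  ∑ i : Fin n, iteratedDeriv 2 (fun t : ℝ => f (x + t • EuclideanSpace.single i (1 : ℝ))) 0

/-- The spherical Radon transform with centers on the unit sphere. -/
def RadonS (n : ℕ) (f : Esp n → ℝ) (y : Esp n) (r : ℝ) : ℝ :=
  ∫ ω in unitSphere n, f (y + r • ω) * r ^ (n - 1) ∂(sphMeasure n)

/-- The spherical means operator with centers on the unit sphere. -/
def Msph (n : ℕ) (f : Esp n → ℝ) (y : Esp n) (r : ℝ) : ℝ :=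
  (1 / (sphMeasure n (unitSphere n)).toReal) * ∫ ω in unitSphere n, f (y + r • ω) ∂(sphMeasure n)

/-- The kernel `K_n(y,s)` built from the real and imaginary parts of `G`. -/
def Kker (n : ℕ) (f : Esp n → ℝ) (y : Esp n) (s : ℝ) : ℝ :=
  ∫ lam in Set.Ioi (0 : ℝ),
    lam * (GreenG n s lam).re * ∫ r in Set.Ioi (0 : ℝ), RadonS n f y r * (GreenG n r lam).im

/-- The time Fourier transform `(1/2π) ∫ v(t) e^{iλt} dt` of a real-valued function. -/
def timeFT (v : ℝ → ℝ) (lam : ℝ) : ℂ :=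
  (1 / (2 * Real.pi)) * ∫ t : ℝ, (v t : ℂ) * Complex.exp (Complex.I * lam * t)

/-- The operator `w ↦ d/dr (w(r)/r)`. -/
def DWop (w : ℝ → ℝ) : ℝ → ℝ := fun r => deriv (fun r' => w r' / r') r

open scoped Topology ENNReal NNReal Interval

/-- The parametrization `θ ↦ (cos θ, sin θ)` of the unit circle. -/
def circlePt (θ : ℝ) : Esp 2 := Complex.orthonormalBasisOneI.repr (circleMap 0 1 θ)

lemma continuous_circlePt : Continuous circlePt :=
  Complex.orthonormalBasisOneI.repr.continuous.comp (continuous_circleMap 0 1)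

lemma dist_circlePt (s t : ℝ) : dist (circlePt s) (circlePt t) = |2 * Real.sin ((s - t) / 2)| := by
  have h := Complex.norm_exp_I_mul_ofReal_sub_one (s - t)
  rw [circlePt, circlePt, LinearIsometryEquiv.dist_map, dist_eq_norm]
  have h2 : circleMap 0 1 s - circleMap 0 1 t
      = Complex.exp (t * Complex.I) * (Complex.exp (Complex.I * (s - t : ℝ)) - 1) := by
    rw [mul_sub, ← Complex.exp_add]
    simp only [circleMap_zero, Complex.ofReal_one, one_mul, mul_one]
    congr 2
    push_cast
    ring
  rw [h2, norm_mul, Complex.norm_exp_ofReal_mul_I, one_mul, h, Real.norm_eq_abs]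

lemma lipschitzWith_circlePt : LipschitzWith 1 circlePt := by
  refine LipschitzWith.of_dist_le_mul fun s t => ?_
  rw [dist_circlePt, Real.dist_eq, abs_mul, abs_two, NNReal.coe_one, one_mul]
  have := Real.abs_sin_le_abs (x := (s - t) / 2)
  rw [abs_div, abs_two] at this
  linarith

lemma image_circlePt : circlePt '' Set.Ioc (-Real.pi) Real.pi = unitSphere 2 := by
  ext y
  constructor
  · rintro ⟨θ, -, rfl⟩
    simp [unitSphere, circlePt]
  · intro hy
    have hy1 : ‖y‖ = 1 := by simpa [unitSphere] using hy
    set z := Complex.orthonormalBasisOneI.repr.symm y with hz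
    refine ⟨Complex.arg z, Complex.arg_mem_Ioc z, ?_⟩
    have hz1 : ‖z‖ = 1 := by rw [hz, LinearIsometryEquiv.norm_map, hy1]
    have : circleMap 0 1 (Complex.arg z) = z := by
      conv_rhs => rw [← Complex.norm_mul_exp_arg_mul_I z, hz1]
      simp [circleMap]
    rw [circlePt, this, hz, LinearIsometryEquiv.apply_symm_apply]

lemma injOn_circlePt : Set.InjOn circlePt (Set.Ioc (-Real.pi) Real.pi) := by
  intro s hs t ht h
  have h1 := Complex.orthonormalBasisOneI.repr.injective h
  have := injOn_circleMap_of_abs_sub_le (a := -Real.pi) (b := Real.pi) (c := 0)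
    one_ne_zero (by rw [abs_le]; constructor <;> linarith [Real.pi_pos])
  rw [Set.uIoc_of_le (by linarith [Real.pi_pos])] at this
  exact this hs ht h1

lemma exists_le_dist_circlePt {K : ℝ} (hK : 1 < K) :
    ∃ δ > 0, ∀ s t : ℝ, |s - t| ≤ δ → |s - t| ≤ K * dist (circlePt s) (circlePt t) := by
  refine ⟨min 1 (1 - 1 / K), lt_min one_pos ?_, ?_⟩
  · have : 1 / K < 1 := by rw [div_lt_one (by linarith)]; exact hK
    linarith
  intro s t hst
  rw [dist_circlePt, abs_mul, abs_two]
  have h1 : |s - t| ≤ 1 := hst.trans (min_le_left _ _)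
  have h2 : |s - t| ≤ 1 - 1 / K := hst.trans (min_le_right _ _)
  set x := |s - t| with hx
  have hsin : |Real.sin ((s - t) / 2)| = Real.sin (x / 2) := by
    rw [hx]
    rcases abs_cases (s - t) with ⟨h, h'⟩ | ⟨h, h'⟩
    · rw [h, abs_of_nonneg]
      apply Real.sin_nonneg_of_nonneg_of_le_pi <;> linarith [Real.pi_gt_three]
    · rw [h, neg_div, Real.sin_neg, abs_of_nonpos]
      rw [← neg_neg ((s - t) / 2), Real.sin_neg, neg_nonpos]
      apply Real.sin_nonneg_of_nonneg_of_le_pi <;> linarith [Real.pi_gt_three]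
  rw [hsin]
  rcases (abs_nonneg (s - t)).eq_or_lt with h0 | h0
  · rw [← hx] at h0
    simp [← h0]
  rw [← hx] at h0
  have h3 := Real.sin_gt_sub_cube (x := x / 2) (by linarith)
  have h4 : x * (1 / K) ≤ 2 * Real.sin (x / 2) := by
    have : x * x ^ 2 ≤ x * x := by
      apply mul_le_mul_of_nonneg_left _ h0.le
      nlinarith
    nlinarith [mul_nonneg h0.le (sub_nonneg.2 h2)]
  calc x = K * (x * (1 / K)) := by field_simp
    _ ≤ _ := mul_le_mul_of_nonneg_left h4 (by linarith)

lemma volume_le_hausdorffMeasure_circlePt {K : ℝ≥0} {A : Set ℝ}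
    (h : ∀ s ∈ A, ∀ t ∈ A, |s - t| ≤ K * dist (circlePt s) (circlePt t)) :
    volume A ≤ K * μH[1] (circlePt '' A) := by
  have inj : Set.InjOn circlePt A := by
    intro s hs t ht e
    have := h s hs t ht
    rw [e, dist_self, mul_zero] at this
    exact sub_eq_zero.1 (abs_eq_zero.1 (le_antisymm this (abs_nonneg _)))
  have hL : LipschitzOnWith K (Function.invFunOn circlePt A) (circlePt '' A) := by
    refine LipschitzOnWith.of_dist_le_mul ?_
    rintro _ ⟨s, hs, rfl⟩ _ ⟨t, ht, rfl⟩
    rw [inj.leftInvOn_invFunOn hs, inj.leftInvOn_invFunOn ht, Real.dist_eq]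
    exact h s hs t ht
  have := hL.hausdorffMeasure_image_le (d := 1) zero_le_one
  rw [inj.leftInvOn_invFunOn.image_image, hausdorffMeasure_real, ENNReal.rpow_one] at this
  exact this

lemma hausdorffMeasure_image_circlePt {A : Set ℝ} (hA : MeasurableSet A)
    (hA' : A ⊆ Set.Ioc (-Real.pi) Real.pi) : μH[1] (circlePt '' A) = volume A := by
  apply le_antisymm
  · have := lipschitzWith_circlePt.hausdorffMeasure_image_le (d := 1) zero_le_one A
    simpa [hausdorffMeasure_real] using this
  · have hlim : Filter.Tendsto (fun K : ℝ≥0 => (K : ℝ≥0∞) * μH[1] (circlePt '' A)) (𝓝[>] 1)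
        (𝓝 (1 * μH[1] (circlePt '' A))) :=
      ENNReal.Tendsto.mul_const (ENNReal.tendsto_coe.2 (Filter.tendsto_id.mono_left
        nhdsWithin_le_nhds)) (Or.inl one_ne_zero)
    rw [one_mul] at hlim
    refine ge_of_tendsto hlim ?_
    filter_upwards [self_mem_nhdsWithin] with K hK'
    have hK : (1 : ℝ) < K := by exact_mod_cast hK'
    obtain ⟨δ, hδ, hd⟩ := exists_le_dist_circlePt hK
    let I : ℤ → Set ℝ := fun n => A ∩ Set.Ioc (n • δ) ((n + 1) • δ)
    have hIU : A = ⋃ n, I n := by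
      rw [← Set.inter_iUnion, iUnion_Ioc_zsmul hδ, Set.inter_univ]
    have hIm : ∀ n, MeasurableSet (I n) := fun n => hA.inter measurableSet_Ioc
    have hId : Pairwise (Disjoint on I) := fun m n hmn =>
      ((Set.pairwise_disjoint_Ioc_zsmul δ) hmn).mono Set.inter_subset_right Set.inter_subset_right
    have hIs : ∀ n, I n ⊆ Set.Ioc (-Real.pi) Real.pi := fun n => Set.inter_subset_left.trans hA'
    conv_lhs => rw [hIU]
    conv_rhs => rw [hIU]
    rw [Set.image_iUnion, measure_iUnion hId hIm, measure_iUnion, ← ENNReal.tsum_mul_left]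
    · refine ENNReal.tsum_le_tsum fun n => volume_le_hausdorffMeasure_circlePt ?_
      rintro s ⟨-, hs⟩ t ⟨-, ht⟩
      apply hd
      have : (n + 1) • δ = n • δ + δ := by rw [add_smul, one_smul]
      rw [this] at hs ht
      rw [abs_le]
      constructor <;> linarith [hs.1, hs.2, ht.1, ht.2]
    · intro m n hmn
      rw [Function.onFun, Set.disjoint_left]
      rintro _ ⟨a, ha, rfl⟩ ⟨b, hb, hab⟩
      rw [injOn_circlePt (hIs n hb) (hIs m ha) hab] at hb
      exact Set.disjoint_left.1 (hId hmn) ha hb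
    · intro n
      exact (hIm n).image_of_continuousOn_injOn continuous_circlePt.continuousOn
        (injOn_circlePt.mono (hIs n))

lemma integral_unitSphere (φ : Esp 2 → ℝ) :
    ∫ y in unitSphere 2, φ y ∂(sphMeasure 2) = ∫ θ in -Real.pi..Real.pi, φ (circlePt θ) := by
  set s := Set.Ioc (-Real.pi) Real.pi with hs
  have hsm : MeasurableSet s := measurableSet_Ioc
  have hE : MeasurableEmbedding (s.domRestrict circlePt) :=
    continuous_circlePt.continuousOn.measurableEmbedding hsm injOn_circlePt
  have hμ : (sphMeasure 2).restrict (unitSphere 2)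
      = Measure.map (s.domRestrict circlePt) (Measure.comap Subtype.val volume) := by
    ext B hB
    rw [Measure.restrict_apply hB, hE.map_apply,
      (MeasurableEmbedding.subtype_coe hsm).comap_apply, ← hausdorffMeasure_image_circlePt]
    · have : ((2 : ℕ) : ℝ) - 1 = 1 := by norm_num
      rw [sphMeasure, this]
      congr 1
      rw [← image_circlePt]
      ext y
      constructor
      · rintro ⟨hy, θ, hθ, rfl⟩
        exact ⟨θ, ⟨⟨θ, hθ⟩, hy, rfl⟩, rfl⟩
      · rintro ⟨_, ⟨⟨θ, hθ⟩, hy, rfl⟩, rfl⟩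
        exact ⟨hy, θ, hθ, rfl⟩
    · exact (MeasurableEmbedding.subtype_coe hsm).measurableSet_image.2 (hE.measurable hB)
    · rintro _ ⟨⟨θ, hθ⟩, -, rfl⟩
      exact hθ
  rw [hμ, hE.integral_map, intervalIntegral.integral_of_le (by linarith [Real.pi_pos]),
    ← integral_subtype_comap hsm]
  rfl

lemma hasDerivAt_intervalIntegral_of_continuous {G G' : ℝ → ℝ → ℝ} {a b : ℝ}
    (hG : ∀ r, Continuous (G r)) (hG' : Continuous (uncurry G'))
    (h : ∀ r θ, HasDerivAt (fun s => G s θ) (G' r θ) r) (r : ℝ) :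
    HasDerivAt (fun s => ∫ θ in a..b, G s θ) (∫ θ in a..b, G' r θ) r := by
  obtain ⟨C, hC⟩ := ((isCompact_closedBall r 1).prod
    (isCompact_uIcc (a := a) (b := b))).exists_bound_of_continuousOn hG'.continuousOn
  refine (intervalIntegral.hasDerivAt_integral_of_dominated_loc_of_deriv_le
    (bound := fun _ => C) (Metric.closedBall_mem_nhds r one_pos)
    (Filter.Eventually.of_forall fun s => (hG s).aestronglyMeasurable)
    ((hG r).intervalIntegrable a b)
    (hG'.comp (Continuous.prodMk_right r)).aestronglyMeasurable
    (Filter.Eventually.of_forall fun θ hθ s hs => hC (s, θ) ⟨hs, Set.uIoc_subset_uIcc hθ⟩)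
    intervalIntegrable_const
    (Filter.Eventually.of_forall fun θ _ s _ => h s θ)).2

/-- The Laplacian of a function on the complex plane. -/
def planeLaplacian (F : ℂ → ℝ) (z : ℂ) : ℝ :=
  fderiv ℝ (fderiv ℝ F) z 1 1 + fderiv ℝ (fderiv ℝ F) z Complex.I Complex.I

section Smooth

variable {F : ℂ → ℝ}

lemma continuous_fderiv_fderiv (hF : ContDiff ℝ (⊤ : ℕ∞) F) :
    Continuous (fderiv ℝ (fderiv ℝ F)) :=
  (hF.fderiv_right (m := 1) (by norm_cast)).continuous_fderiv one_ne_zero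

lemma continuous_planeLaplacian (hF : ContDiff ℝ (⊤ : ℕ∞) F) : Continuous (planeLaplacian F) := by
  have := continuous_fderiv_fderiv hF
  unfold planeLaplacian
  fun_prop

lemma planeLaplacian_eq_of_norm_eq_one (F : ℂ → ℝ) (z : ℂ) {e : ℂ} (he : ‖e‖ = 1) :
    fderiv ℝ (fderiv ℝ F) z e e
      + fderiv ℝ (fderiv ℝ F) z (Complex.I * e) (Complex.I * e) = planeLaplacian F z := by
  set T := fderiv ℝ (fderiv ℝ F) z with hT
  have h1 : e = e.re • (1 : ℂ) + e.im • Complex.I := by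
    simp [Complex.re_add_im]
  have h2 : Complex.I * e = (-e.im) • (1 : ℂ) + e.re • Complex.I := by
    apply Complex.ext <;> simp
  have h3 : e.re ^ 2 + e.im ^ 2 = 1 := by
    have := Complex.sq_norm e
    rw [he, Complex.normSq_apply] at this
    linarith
  rw [h2]
  conv_lhs => enter [1]; rw [h1]
  simp only [map_add, map_smul, add_apply, smul_apply,
    smul_eq_mul, planeLaplacian, ← hT]
  linear_combination (T 1 1 + T Complex.I Complex.I) * h3

lemma hasDerivAt_circleMap_unit (θ : ℝ) :
    HasDerivAt (circleMap 0 1) (Complex.I * circleMap 0 1 θ) θ := by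
  simpa [mul_comm] using hasDerivAt_circleMap 0 1 θ

lemma hasDerivAt_circleMean (hF : ContDiff ℝ (⊤ : ℕ∞) F) (y : ℂ) (r : ℝ) :
    HasDerivAt (fun s : ℝ => ∫ θ in -Real.pi..Real.pi, F (y + s • circleMap 0 1 θ))
      (∫ θ in -Real.pi..Real.pi, fderiv ℝ F (y + r • circleMap 0 1 θ) (circleMap 0 1 θ)) r := by
  have hc := continuous_circleMap 0 1
  have hF' : Continuous (fderiv ℝ F) := hF.continuous_fderiv (by simp)
  refine hasDerivAt_intervalIntegral_of_continuous
    (G' := fun r θ => fderiv ℝ F (y + r • circleMap 0 1 θ) (circleMap 0 1 θ)) ?_ ?_ ?_ r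
  · intro s
    have := hF.continuous
    fun_prop
  · unfold uncurry
    fun_prop
  · intro s θ
    have h1 : HasDerivAt (fun s : ℝ => y + s • circleMap 0 1 θ) (circleMap 0 1 θ) s := by
      simpa using ((hasDerivAt_id s).smul_const (circleMap 0 1 θ)).const_add y
    exact ((hF.differentiable (by simp)) _).hasFDerivAt.comp_hasDerivAt s h1

lemma hasDerivAt_mul_circleMean_fderiv (hF : ContDiff ℝ (⊤ : ℕ∞) F) (y : ℂ) (r : ℝ) :
    HasDerivAt (fun s : ℝ => s * ∫ θ in -Real.pi..Real.pi,
        fderiv ℝ F (y + s • circleMap 0 1 θ) (circleMap 0 1 θ))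
      (r * ∫ θ in -Real.pi..Real.pi, planeLaplacian F (y + r • circleMap 0 1 θ)) r := by
  have hc := continuous_circleMap 0 1
  have hF1 : ContDiff ℝ 1 (fderiv ℝ F) := hF.fderiv_right (by norm_cast)
  have hF' : Continuous (fderiv ℝ F) := hF1.continuous
  have hF'' := continuous_fderiv_fderiv hF
  have hd : ∀ z, HasFDerivAt (fderiv ℝ F) (fderiv ℝ (fderiv ℝ F) z) z :=
    fun z => ((hF1.differentiable one_ne_zero) z).hasFDerivAt
  have h1 : HasDerivAt (fun s : ℝ => ∫ θ in -Real.pi..Real.pi,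
        fderiv ℝ F (y + s • circleMap 0 1 θ) (circleMap 0 1 θ))
      (∫ θ in -Real.pi..Real.pi,
        fderiv ℝ (fderiv ℝ F) (y + r • circleMap 0 1 θ) (circleMap 0 1 θ) (circleMap 0 1 θ)) r := by
    refine hasDerivAt_intervalIntegral_of_continuous (G' := fun r θ =>
      fderiv ℝ (fderiv ℝ F) (y + r • circleMap 0 1 θ) (circleMap 0 1 θ) (circleMap 0 1 θ))
      ?_ ?_ ?_ r
    · intro s
      fun_prop
    · unfold uncurry
      fun_prop
    · intro s θ
      have h1 : HasDerivAt (fun s : ℝ => y + s • circleMap 0 1 θ) (circleMap 0 1 θ) s := by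
        simpa using ((hasDerivAt_id s).smul_const (circleMap 0 1 θ)).const_add y
      simpa using ((hd _).comp_hasDerivAt s h1).clm_apply (hasDerivAt_const s (circleMap 0 1 θ))
  have h2 : ∫ θ in -Real.pi..Real.pi, (r * fderiv ℝ (fderiv ℝ F) (y + r • circleMap 0 1 θ)
        (Complex.I * circleMap 0 1 θ) (Complex.I * circleMap 0 1 θ)
      - fderiv ℝ F (y + r • circleMap 0 1 θ) (circleMap 0 1 θ)) = 0 := by
    rw [intervalIntegral.integral_eq_sub_of_hasDerivAt (f := fun θ =>
      fderiv ℝ F (y + r • circleMap 0 1 θ) (Complex.I * circleMap 0 1 θ))]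
    · have : circleMap 0 1 Real.pi = circleMap 0 1 (-Real.pi) := by simp [circleMap]
      rw [this, sub_self]
    · intro θ _
      have e1 : HasDerivAt (fun θ : ℝ => y + r • circleMap 0 1 θ)
          (r • (Complex.I * circleMap 0 1 θ)) θ :=
        ((hasDerivAt_circleMap_unit θ).const_smul r).const_add y
      have e2 : HasDerivAt (fun θ : ℝ => Complex.I * circleMap 0 1 θ) (-circleMap 0 1 θ) θ := by
        have := (hasDerivAt_circleMap_unit θ).const_mul Complex.I
        rwa [← mul_assoc, Complex.I_mul_I, neg_one_mul] at this
      have := ((hd _).comp_hasDerivAt θ e1).clm_apply e2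
      refine this.congr_deriv ?_
      rw [map_smul, map_neg, sub_eq_add_neg]
      rfl
    · apply Continuous.intervalIntegrable
      fun_prop
  rw [intervalIntegral.integral_sub (by apply Continuous.intervalIntegrable; fun_prop)
    (by apply Continuous.intervalIntegrable; fun_prop), sub_eq_zero,
    intervalIntegral.integral_const_mul] at h2
  have h3 := (hasDerivAt_id r).mul h1
  refine h3.congr_deriv ?_
  rw [one_mul, ← h2, id, ← mul_add, ← intervalIntegral.integral_add
    (by apply Continuous.intervalIntegrable; fun_prop)
    (by apply Continuous.intervalIntegrable; fun_prop)]
  congr 1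
  refine intervalIntegral.integral_congr fun θ _ => ?_
  rw [add_comm, planeLaplacian_eq_of_norm_eq_one F _ (by simp)]

lemma fderiv_eq_zero_of_one_lt_norm (h0 : ∀ z, 1 < ‖z‖ → F z = 0) {z : ℂ} (hz : 1 < ‖z‖) :
    fderiv ℝ F z = 0 := by
  have : F =ᶠ[𝓝 z] fun _ => 0 := by
    filter_upwards [(isOpen_lt continuous_const continuous_norm).mem_nhds hz] with w hw
    exact h0 w hw
  rw [this.fderiv_eq, fderiv_const_apply]

lemma planeLaplacian_eq_zero_of_one_lt_norm (h0 : ∀ z, 1 < ‖z‖ → F z = 0) {z : ℂ}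
    (hz : 1 < ‖z‖) : planeLaplacian F z = 0 := by
  have : fderiv ℝ F =ᶠ[𝓝 z] fun _ => 0 := by
    filter_upwards [(isOpen_lt continuous_const continuous_norm).mem_nhds hz] with w hw
    exact fderiv_eq_zero_of_one_lt_norm h0 hw
  rw [planeLaplacian, this.fderiv_eq]
  simp

lemma one_lt_norm_add_two_smul_circleMap {x : ℂ} (hx : ‖x‖ < 1) (θ : ℝ) :
    1 < ‖x + (2 : ℝ) • circleMap 0 1 θ‖ := by
  have h := norm_sub_norm_le ((2 : ℝ) • circleMap 0 1 θ) (-x)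
  rw [norm_smul, norm_circleMap_zero, norm_neg, sub_neg_eq_add, add_comm _ x, abs_one, mul_one,
    Real.norm_eq_abs, abs_two] at h
  linarith

lemma continuous_circleMean {h : ℂ → ℝ} (hh : Continuous h) (y : ℂ) :
    Continuous fun r : ℝ => ∫ θ in -Real.pi..Real.pi, h (y + r • circleMap 0 1 θ) := by
  have hc := continuous_circleMap 0 1
  apply intervalIntegral.continuous_parametric_intervalIntegral_of_continuous'
  unfold uncurry
  fun_prop

lemma integral_radial_planeLaplacian_mul_log (hF : ContDiff ℝ (⊤ : ℕ∞) F)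
    (h0 : ∀ z, 1 < ‖z‖ → F z = 0) {x : ℂ} (hx : ‖x‖ < 1) :
    ∫ r in (0 : ℝ)..2, (r * ∫ θ in -Real.pi..Real.pi,
      planeLaplacian F (x + r • circleMap 0 1 θ)) * Real.log r = 2 * Real.pi * F x := by
  set m : ℝ → ℝ := fun s => ∫ θ in -Real.pi..Real.pi, F (x + s • circleMap 0 1 θ) with hm
  set m' : ℝ → ℝ := fun s => ∫ θ in -Real.pi..Real.pi,
    fderiv ℝ F (x + s • circleMap 0 1 θ) (circleMap 0 1 θ) with hm'
  have hmd : ∀ r, HasDerivAt m (m' r) r := hasDerivAt_circleMean hF x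
  have hmc : Continuous m := continuous_circleMean hF.continuous x
  have hmc' : Continuous m' := by
    have hc := continuous_circleMap 0 1
    have hF' : Continuous (fderiv ℝ F) := hF.continuous_fderiv (by simp)
    apply intervalIntegral.continuous_parametric_intervalIntegral_of_continuous'
    unfold uncurry
    fun_prop
  rw [intervalIntegral.integral_eq_sub_of_hasDerivAt_of_le
    (f := fun r => r * m' r * Real.log r - m r) (by norm_num)]
  · have e1 : m' 2 = 0 := by
      refine (intervalIntegral.integral_congr (g := fun _ => (0 : ℝ)) fun θ _ => ?_).trans
        intervalIntegral.integral_zero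
      simp only
      rw [fderiv_eq_zero_of_one_lt_norm h0 (one_lt_norm_add_two_smul_circleMap hx θ)]
      rfl
    have e2 : m 2 = 0 := by
      exact (intervalIntegral.integral_congr (g := fun _ => (0 : ℝ)) fun θ _ =>
        h0 _ (one_lt_norm_add_two_smul_circleMap hx θ)).trans intervalIntegral.integral_zero
    have e3 : m 0 = 2 * Real.pi * F x := by
      simp only [hm, zero_smul, add_zero, intervalIntegral.integral_const, smul_eq_mul]
      ring
    simp [e1, e2, e3]
  · apply Continuous.continuousOn
    have : Continuous fun r => m' r * (r * Real.log r) - m r :=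
      (hmc'.mul Real.continuous_mul_log).sub hmc
    convert this using 2
    ring
  · intro r hr
    have h1 := hasDerivAt_mul_circleMean_fderiv hF x r
    have h2 := (h1.mul (Real.hasDerivAt_log hr.1.ne')).sub (hmd r)
    refine h2.congr_deriv ?_
    have := hr.1.ne'
    simp only [hm']
    field_simp
    ring
  · have : Continuous fun r => (∫ θ in -Real.pi..Real.pi,
        planeLaplacian F (x + r • circleMap 0 1 θ)) * (r * Real.log r) :=
      (continuous_circleMean (continuous_planeLaplacian hF) x).mul Real.continuous_mul_log
    apply Continuous.intervalIntegrable
    convert this using 2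
    ring

end Smooth

lemma polarCoord_symm_eq_smul_circleMap (p : ℝ × ℝ) :
    Complex.polarCoord.symm p = p.1 • circleMap 0 1 p.2 := by
  rw [Complex.polarCoord_symm_apply, circleMap_zero, Complex.exp_mul_I]
  simp [mul_add]

lemma integral_radial_mul_circleMean {h : ℂ → ℝ} (hh : Continuous h) {y : ℂ} {R : ℝ} (hR : 0 ≤ R)
    (h0 : ∀ w : ℂ, R < ‖w‖ → h (y + w) = 0) {k : ℝ → ℝ} (hk : IntervalIntegrable k volume 0 R) :
    ∫ r in (0 : ℝ)..R, (r * ∫ θ in -Real.pi..Real.pi, h (y + r • circleMap 0 1 θ)) * k r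
      = ∫ z, h z * k ‖z - y‖ := by
  have hc := continuous_circleMap 0 1
  have hpi : -Real.pi ≤ Real.pi := by linarith [Real.pi_pos]
  set q : ℝ × ℝ → ℝ := fun p => (p.1 * h (y + p.1 • circleMap 0 1 p.2)) * k p.1 with hq
  have hint : IntegrableOn q (Set.Ioc 0 R ×ˢ Set.Ioc (-Real.pi) Real.pi) (volume.prod volume) := by
    have h1 : Continuous fun p : ℝ × ℝ => p.1 * h (y + p.1 • circleMap 0 1 p.2) := by fun_prop
    obtain ⟨C, hC⟩ := ((isCompact_Icc (a := (0 : ℝ)) (b := R)).prod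
      (isCompact_Icc (a := -Real.pi) (b := Real.pi))).exists_bound_of_continuousOn h1.continuousOn
    rw [IntegrableOn, ← Measure.prod_restrict]
    have h2 : Integrable (fun p : ℝ × ℝ => k p.1) ((volume.restrict (Set.Ioc 0 R)).prod
        (volume.restrict (Set.Ioc (-Real.pi) Real.pi))) :=
      ((intervalIntegrable_iff_integrableOn_Ioc_of_le hR).1 hk).comp_fst _
    refine h2.bdd_mul (c := C) h1.aestronglyMeasurable ?_
    rw [Measure.prod_restrict]
    refine (ae_restrict_iff' (measurableSet_Ioc.prod measurableSet_Ioc)).2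
      (Filter.Eventually.of_forall fun p hp => ?_)
    exact hC p ⟨Set.Ioc_subset_Icc_self hp.1, Set.Ioc_subset_Icc_self hp.2⟩
  symm
  calc ∫ z, h z * k ‖z - y‖ = ∫ w, h (y + w) * k ‖w‖ := by
        rw [← integral_add_left_eq_self _ y]
        simp
    _ = ∫ p in polarCoord.target, q p := by
        rw [← Complex.integral_comp_polarCoord_symm]
        refine setIntegral_congr_fun polarCoord.open_target.measurableSet fun p hp => ?_
        have hp1 : 0 < p.1 := hp.1
        simp only [hq, smul_eq_mul, Complex.norm_polarCoord_symm, abs_of_pos hp1]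
        rw [polarCoord_symm_eq_smul_circleMap, mul_assoc]
    _ = ∫ p in Set.Ioc 0 R ×ˢ Set.Ioo (-Real.pi) Real.pi, q p := by
        refine setIntegral_eq_of_subset_of_forall_sdiff_eq_zero
          polarCoord.open_target.measurableSet ?_ ?_
        · exact Set.prod_mono Set.Ioc_subset_Ioi_self le_rfl
        · rintro ⟨r, θ⟩ ⟨⟨hr, hθ⟩, hn⟩
          have hr' : 0 < r := hr
          have : R < r := by
            by_contra! hle
            exact hn ⟨⟨hr, hle⟩, hθ⟩
          simp only [hq]
          rw [h0 _ (by rw [norm_smul, norm_circleMap_zero, abs_one, mul_one, Real.norm_eq_abs,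
            abs_of_pos hr']; exact this)]
          ring
    _ = ∫ r in Set.Ioc 0 R, ∫ θ in Set.Ioo (-Real.pi) Real.pi, q (r, θ) :=
        setIntegral_prod q (hint.mono_set (Set.prod_mono le_rfl Set.Ioo_subset_Ioc_self))
    _ = _ := by
        rw [intervalIntegral.integral_of_le hR]
        refine integral_congr_ae (Filter.Eventually.of_forall fun r => ?_)
        simp only
        rw [← integral_Ioc_eq_integral_Ioo, ← intervalIntegral.integral_of_le hpi,
          ← intervalIntegral.integral_const_mul, ← intervalIntegral.integral_mul_const]

lemma intervalIntegrable_log_abs_sq_sub (d a b : ℝ) :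
    IntervalIntegrable (fun r => Real.log |r ^ 2 - d|) volume a b := by
  have : MeromorphicOn (fun r : ℝ => r ^ 2 - d) (Set.uIcc a b) := fun r _ => by fun_prop
  exact this.intervalIntegrable_log_norm

lemma intervalIntegrable_log_norm_circleMap_sub (u : ℂ) :
    IntervalIntegrable (fun θ => Real.log ‖circleMap 0 1 θ - u‖) volume (-Real.pi) Real.pi := by
  have h : Function.Periodic (fun θ => Real.log ‖circleMap 0 1 θ - u‖) (2 * Real.pi) :=
    fun θ => by simp [periodic_circleMap 0 1 θ]
  exact h.intervalIntegrable₀ Real.two_pi_pos.ne'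
    (circleIntegrable_log_norm_sub_const (a := u) (c := 0) 1) _ _

lemma integral_log_norm_circleMap_sub {u : ℂ} (hu : ‖u‖ = 1) :
    ∫ θ in -Real.pi..Real.pi, Real.log ‖circleMap 0 1 θ - u‖ = 0 := by
  have h : Function.Periodic (fun θ => Real.log ‖circleMap 0 1 θ - u‖) (2 * Real.pi) :=
    fun θ => by simp [periodic_circleMap 0 1 θ]
  have h1 := h.intervalIntegral_add_eq (-Real.pi) 0
  have h2 := circleAverage_log_norm_sub_const₁ hu
  rw [Real.circleAverage_def, smul_eq_zero] at h2
  have h3 : -Real.pi + 2 * Real.pi = Real.pi := by ring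
  rw [zero_add, h3] at h1
  rw [h1]
  exact h2.resolve_left (inv_ne_zero Real.two_pi_pos.ne')

lemma exists_abs_sq_sub_sq_eq_mul {x z : ℂ} (hx : ‖x‖ ≤ 1) (hz : ‖z‖ ≤ 1) (hxz : z ≠ x) :
    ∃ u v : ℂ, ‖u‖ = 1 ∧ ‖v‖ = 1 ∧ ∀ p : ℂ, ‖p‖ = 1 →
      |‖z - p‖ ^ 2 - ‖x - p‖ ^ 2| = ‖z - x‖ * (‖p - u‖ * ‖p - v‖) := by
  have hn : 0 < ‖z - x‖ := norm_pos_iff.2 (sub_ne_zero.2 hxz)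
  set n := ‖z - x‖ with hnd
  set a := (‖z‖ ^ 2 - ‖x‖ ^ 2) / (2 * n) with ha
  have ha1 : a ^ 2 ≤ 1 := by
    rw [sq_le_one_iff_abs_le_one, ha, abs_div, abs_of_pos (by positivity : 0 < 2 * n),
      div_le_one (by positivity), sq_sub_sq, abs_mul, abs_of_nonneg (by positivity)]
    exact mul_le_mul (by linarith) (abs_norm_sub_norm_le z x) (abs_nonneg _) (by norm_num)
  set b := √(1 - a ^ 2) with hb
  have hab : a ^ 2 + b ^ 2 = 1 := by
    rw [hb, Real.sq_sqrt (by linarith)]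
    ring
  set d := (z - x) / n with hd
  have hd1 : ‖d‖ = 1 := by
    rw [hd, norm_div, Complex.norm_real, norm_norm, ← hnd, div_self hn.ne']
  have hnorm : ∀ c : ℝ, a ^ 2 + c ^ 2 = 1 → ‖d * (a + c * Complex.I)‖ = 1 := by
    intro c hc
    rw [norm_mul, hd1, one_mul, ← sq_eq_sq₀ (norm_nonneg _) zero_le_one, Complex.sq_norm,
      Complex.normSq_add_mul_I, hc, one_pow]
  refine ⟨d * (a + b * Complex.I), d * (a + (-b : ℝ) * Complex.I), hnorm b hab,
    hnorm (-b) (by rw [neg_sq, hab]), fun p hp => ?_⟩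
  have hpp : p * (starRingEnd ℂ) p = 1 := by
    rw [Complex.mul_conj, Complex.normSq_eq_norm_sq, hp]; norm_num
  have hdd : d * (starRingEnd ℂ) d = 1 := by
    rw [Complex.mul_conj, Complex.normSq_eq_norm_sq, hd1]; norm_num
  have hab' : (a : ℂ) ^ 2 + (b : ℂ) ^ 2 = 1 := by exact_mod_cast hab
  have hnC : (n : ℂ) ≠ 0 := by exact_mod_cast hn.ne'
  have hsq : ∀ w : ℂ, ((‖w‖ ^ 2 : ℝ) : ℂ) = w * (starRingEnd ℂ) w := by
    intro w
    rw [Complex.mul_conj, Complex.normSq_eq_norm_sq]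
  have haC : 2 * (n : ℂ) * a = z * (starRingEnd ℂ) z - x * (starRingEnd ℂ) x := by
    rw [← hsq, ← hsq, ha]
    push_cast
    field_simp
  have hzx : z = x + n * d := by
    rw [hd]
    field_simp
    ring
  have key : (n : ℂ) * ((p - d * (a + b * Complex.I)) * (p - d * (a + (-b : ℝ) * Complex.I)))
      = -(p * d * ((‖z - p‖ ^ 2 - ‖x - p‖ ^ 2 : ℝ) : ℂ)) := by
    rw [Complex.ofReal_sub, hsq, hsq]
    rw [hzx] at haC ⊢
    simp only [map_add, map_sub, map_mul, Complex.conj_ofReal, Complex.ofReal_neg] at haC ⊢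
    have hI : Complex.I ^ 2 = -1 := Complex.I_sq
    linear_combination (n * d ^ 2) * hab' - n * d ^ 2 * b ^ 2 * hI - p * d * haC - n * d ^ 2 * hpp - n * p ^ 2 * hdd
  have := congrArg norm key
  rw [norm_mul, norm_mul, norm_neg, norm_mul, norm_mul, hp, hd1, Complex.norm_real,
    Complex.norm_real, Real.norm_eq_abs, Real.norm_eq_abs, abs_of_pos hn] at this
  rw [this]
  ring

lemma ae_circleMap_ne (u : ℂ) :
    ∀ᵐ θ, θ ∈ Set.uIoc (-Real.pi) Real.pi → circleMap 0 1 θ ≠ u := by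
  have inj := injOn_circleMap_of_abs_sub_le (a := -Real.pi) (b := Real.pi) (c := 0)
    one_ne_zero (by rw [abs_le]; constructor <;> linarith [Real.pi_pos])
  have hs : (Set.uIoc (-Real.pi) Real.pi ∩ {θ | circleMap 0 1 θ = u}).Subsingleton :=
    fun s hs t ht => inj hs.1 ht.1 (hs.2.trans ht.2.symm)
  filter_upwards [compl_mem_ae_iff.2 (hs.measure_zero volume)] with θ hθ h1 h2
  exact hθ ⟨h1, h2⟩

lemma integral_log_abs_sq_sub_sq {x z : ℂ} (hx : ‖x‖ ≤ 1) (hz : ‖z‖ ≤ 1) (hxz : z ≠ x) :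
    IntervalIntegrable (fun θ => Real.log |‖z - circleMap 0 1 θ‖ ^ 2 - ‖x - circleMap 0 1 θ‖ ^ 2|)
      volume (-Real.pi) Real.pi ∧
    ∫ θ in -Real.pi..Real.pi,
      Real.log |‖z - circleMap 0 1 θ‖ ^ 2 - ‖x - circleMap 0 1 θ‖ ^ 2|
      = 2 * Real.pi * Real.log ‖z - x‖ := by
  obtain ⟨u, v, hu, hv, h⟩ := exists_abs_sq_sub_sq_eq_mul hx hz hxz
  have hae : ∀ᵐ θ, θ ∈ Set.uIoc (-Real.pi) Real.pi →
      Real.log ‖z - x‖ + (Real.log ‖circleMap 0 1 θ - u‖ + Real.log ‖circleMap 0 1 θ - v‖)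
        = Real.log |‖z - circleMap 0 1 θ‖ ^ 2 - ‖x - circleMap 0 1 θ‖ ^ 2| := by
    filter_upwards [ae_circleMap_ne u, ae_circleMap_ne v] with θ h1 h2 hθ
    have e1 := norm_ne_zero_iff.2 (sub_ne_zero.2 (h1 hθ))
    have e2 := norm_ne_zero_iff.2 (sub_ne_zero.2 (h2 hθ))
    rw [h _ (by simp), Real.log_mul (norm_ne_zero_iff.2 (sub_ne_zero.2 hxz)) (mul_ne_zero e1 e2),
      Real.log_mul e1 e2]
  have iu := intervalIntegrable_log_norm_circleMap_sub u
  have iv := intervalIntegrable_log_norm_circleMap_sub v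
  have ic : IntervalIntegrable (fun _ => Real.log ‖z - x‖) volume (-Real.pi) Real.pi :=
    intervalIntegrable_const
  constructor
  · exact (ic.add (iu.add iv)).congr_ae ((ae_restrict_iff' measurableSet_uIoc).2 hae)
  · rw [← intervalIntegral.integral_congr_ae hae, intervalIntegral.integral_add ic (iu.add iv),
      intervalIntegral.integral_add iu iv, integral_log_norm_circleMap_sub hu,
      integral_log_norm_circleMap_sub hv, intervalIntegral.integral_const, smul_eq_mul]
    ring

lemma abs_log_le_eight_sub_log {t : ℝ} (ht : 0 ≤ t) (ht' : t ≤ 4) :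
    |Real.log t| ≤ 8 - Real.log t := by
  have := Real.log_le_self ht
  rw [abs_le]
  constructor <;> linarith

lemma integrable_mul_log_norm_sub {h : ℂ → ℝ} (hh : Continuous h) (h0 : ∀ z, 1 < ‖z‖ → h z = 0)
    {x : ℂ} (hx : ‖x‖ < 1) : Integrable fun z => h z * Real.log ‖z - x‖ := by
  set l : ℝ → ℝ := (Set.Iic 2).indicator Real.log with hl
  have hcs : HasCompactSupport h := HasCompactSupport.intro (isCompact_closedBall 0 1)
    fun z hz => h0 z (by simpa using hz)
  have h1 : Integrable fun z : ℂ => l ‖z‖ := by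
    rw [integrable_fun_norm_addHaar, Complex.finrank_real_complex]
    have h2 : IntegrableOn (fun r => r * Real.log r) (Set.Ioc 0 2) :=
      (Real.continuous_mul_log.intervalIntegrable 0 2).1
    have h3 : (fun r : ℝ => r ^ (2 - 1) • l r) = (Set.Iic 2).indicator fun r => r * Real.log r := by
      ext r
      simp only [hl, Set.indicator]
      split_ifs <;> simp
    rw [h3, IntegrableOn, integrable_indicator_iff measurableSet_Iic, IntegrableOn,
      Measure.restrict_restrict measurableSet_Iic, Set.inter_comm, Set.Ioi_inter_Iic]
    exact h2
  obtain ⟨C, hC⟩ := hcs.exists_bound_of_continuous hh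
  have h2 : Integrable fun z : ℂ => h z * l ‖z - x‖ :=
    (h1.comp_sub_right x).bdd_mul hh.aestronglyMeasurable (Filter.Eventually.of_forall hC)
  refine h2.congr (Filter.Eventually.of_forall fun z => ?_)
  simp only
  rcases le_or_gt ‖z‖ 1 with hz | hz
  · have : ‖z - x‖ ≤ 2 := (norm_sub_le z x).trans (by linarith)
    rw [hl, Set.indicator_of_mem (show ‖z - x‖ ∈ Set.Iic 2 from this)]
  · rw [h0 z hz, zero_mul, zero_mul]

lemma integral_circle_integral_mul_log {h : ℂ → ℝ} (hh : Continuous h)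
    (h0 : ∀ z, 1 < ‖z‖ → h z = 0) {x : ℂ} (hx : ‖x‖ < 1) :
    ∫ θ in -Real.pi..Real.pi, ∫ z, h z *
        Real.log |‖z - circleMap 0 1 θ‖ ^ 2 - ‖x - circleMap 0 1 θ‖ ^ 2|
      = 2 * Real.pi * ∫ z, h z * Real.log ‖z - x‖ := by
  have hpi : -Real.pi ≤ Real.pi := by linarith [Real.pi_pos]
  have hcs : HasCompactSupport h := HasCompactSupport.intro (isCompact_closedBall 0 1)
    fun z hz => h0 z (by simpa using hz)
  have hc := continuous_circleMap 0 1
  set L : ℝ → ℂ → ℝ := fun θ z =>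
    Real.log |‖z - circleMap 0 1 θ‖ ^ 2 - ‖x - circleMap 0 1 θ‖ ^ 2| with hL
  set μ := (volume : Measure ℝ).restrict (Set.Ioc (-Real.pi) Real.pi) with hμ
  have hne : ∀ᵐ z : ℂ, z ≠ x := Measure.ae_ne volume x
  have hmeas : Measurable (uncurry fun θ z => h z * L θ z) := by
    have h1 : Continuous fun p : ℝ × ℂ =>
      |‖p.2 - circleMap 0 1 p.1‖ ^ 2 - ‖x - circleMap 0 1 p.1‖ ^ 2| := by fun_prop
    exact (hh.measurable.comp measurable_snd).mul (Real.measurable_log.comp h1.measurable)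
  have hLint : ∀ z, ‖z‖ ≤ 1 → z ≠ x → Integrable (fun θ => L θ z) μ := fun z hz hzx =>
    (integral_log_abs_sq_sub_sq hx.le hz hzx).1.1
  have hLval : ∀ z, ‖z‖ ≤ 1 → z ≠ x → ∫ θ, L θ z ∂μ = 2 * Real.pi * Real.log ‖z - x‖ :=
    fun z hz hzx => by
      rw [← (integral_log_abs_sq_sub_sq hx.le hz hzx).2, intervalIntegral.integral_of_le hpi]
  have hLbound : ∀ z, ‖z‖ ≤ 1 → ∀ θ, |L θ z| ≤ 8 - L θ z := fun z hz θ => by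
    refine abs_log_le_eight_sub_log (abs_nonneg _) ?_
    have hP : ‖circleMap 0 1 θ‖ = 1 := by simp
    have e1 : ‖z - circleMap 0 1 θ‖ ≤ 2 := (norm_sub_le _ _).trans (by linarith)
    have e2 : ‖x - circleMap 0 1 θ‖ ≤ 2 := (norm_sub_le _ _).trans (by linarith)
    rw [abs_le]
    constructor <;> nlinarith [norm_nonneg (z - circleMap 0 1 θ), norm_nonneg (x - circleMap 0 1 θ)]
  have hprod : Integrable (uncurry fun θ z => h z * L θ z) (μ.prod volume) := by
    rw [integrable_prod_iff' hmeas.aestronglyMeasurable]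
    constructor
    · filter_upwards [hne] with z hzx
      rcases le_or_gt ‖z‖ 1 with hz | hz
      · exact (hLint z hz hzx).const_mul (h z)
      · simp only [uncurry, h0 z hz, zero_mul]
        exact integrable_zero _ _ _
    · have hdom : Integrable fun z => |h z| * (16 * Real.pi)
          + 2 * Real.pi * |h z * Real.log ‖z - x‖| :=
        ((hh.integrable_of_hasCompactSupport hcs).abs.mul_const _).add
          ((integrable_mul_log_norm_sub hh h0 hx).abs.const_mul _)
      refine hdom.mono' ?_ ?_
      · exact hmeas.aestronglyMeasurable.norm.prod_swap.integral_prod_right'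
      · filter_upwards [hne] with z hzx
        rcases le_or_gt ‖z‖ 1 with hz | hz
        · rw [Real.norm_of_nonneg (integral_nonneg fun _ => norm_nonneg _)]
          simp only [uncurry, norm_mul, Real.norm_eq_abs]
          rw [integral_const_mul, abs_mul]
          have i8 : Integrable (fun _ : ℝ => (8 : ℝ)) μ := integrable_const _
          have h1 : ∫ θ, |L θ z| ∂μ ≤ ∫ θ, (8 - L θ z) ∂μ :=
            integral_mono (hLint z hz hzx).abs (i8.sub (hLint z hz hzx)) (hLbound z hz)
          have h8 : ∫ _ : ℝ, (8 : ℝ) ∂μ = 16 * Real.pi := by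
            rw [hμ, ← intervalIntegral.integral_of_le hpi, intervalIntegral.integral_const,
              smul_eq_mul]
            ring
          rw [integral_sub i8 (hLint z hz hzx), hLval z hz hzx, h8] at h1
          have h2 : ∫ θ, |L θ z| ∂μ ≤ 16 * Real.pi + 2 * Real.pi * |Real.log ‖z - x‖| := by
            have := mul_le_mul_of_nonneg_left (neg_abs_le (Real.log ‖z - x‖)) Real.two_pi_pos.le
            linarith
          calc _ ≤ |h z| * (16 * Real.pi + 2 * Real.pi * |Real.log ‖z - x‖|) :=
                mul_le_mul_of_nonneg_left h2 (abs_nonneg _)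
            _ = _ := by ring
        · simp [uncurry, h0 z hz]
  rw [intervalIntegral.integral_of_le hpi, integral_integral_swap hprod, ← integral_const_mul]
  refine integral_congr_ae ?_
  filter_upwards [hne] with z hzx
  rw [integral_const_mul]
  rcases le_or_gt ‖z‖ 1 with hz | hz
  · rw [hLval z hz hzx]
    ring
  · rw [h0 z hz]
    ring

lemma circle_inversion {F : ℂ → ℝ} (hF : ContDiff ℝ (⊤ : ℕ∞) F)
    (h0 : ∀ z, 1 < ‖z‖ → F z = 0) {x : ℂ} (hx : ‖x‖ < 1) :
    ∫ φ in -Real.pi..Real.pi, ∫ r in (0 : ℝ)..2, (r * ∫ θ in -Real.pi..Real.pi,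
        planeLaplacian F (circleMap 0 1 φ + r • circleMap 0 1 θ)) *
          Real.log |r ^ 2 - ‖x - circleMap 0 1 φ‖ ^ 2|
      = (2 * Real.pi) ^ 2 * F x := by
  have hc := continuous_planeLaplacian hF
  have hΔ : ∀ z, 1 < ‖z‖ → planeLaplacian F z = 0 :=
    fun z hz => planeLaplacian_eq_zero_of_one_lt_norm h0 hz
  have hfar : ∀ y : ℂ, ‖y‖ ≤ 1 → ∀ w : ℂ, 2 < ‖w‖ → planeLaplacian F (y + w) = 0 := by
    intro y hy w hw
    apply hΔ
    have h := norm_sub_norm_le w (-y)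
    rw [norm_neg, sub_neg_eq_add, add_comm w y] at h
    linarith
  have h1 : ∀ φ : ℝ, ∫ r in (0 : ℝ)..2, (r * ∫ θ in -Real.pi..Real.pi,
        planeLaplacian F (circleMap 0 1 φ + r • circleMap 0 1 θ)) *
          Real.log |r ^ 2 - ‖x - circleMap 0 1 φ‖ ^ 2|
      = ∫ z, planeLaplacian F z *
        Real.log |‖z - circleMap 0 1 φ‖ ^ 2 - ‖x - circleMap 0 1 φ‖ ^ 2| := fun φ =>
    integral_radial_mul_circleMean hc zero_le_two (hfar _ (by simp))
      (intervalIntegrable_log_abs_sq_sub _ 0 2)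
  have h2 := integral_radial_mul_circleMean hc zero_le_two (hfar x hx.le)
    (intervalIntegral.intervalIntegrable_log' (a := 0) (b := 2))
  simp_rw [h1]
  rw [integral_circle_integral_mul_log hc hΔ hx, ← h2,
    integral_radial_planeLaplacian_mul_log hF h0 hx]
  ring

lemma deriv_mul_deriv_circleMean {F : ℂ → ℝ} (hF : ContDiff ℝ (⊤ : ℕ∞) F) (y : ℂ) (c : ℝ) (r : ℝ) :
    deriv (fun r' : ℝ => r' * deriv (fun s : ℝ =>
        c * ∫ θ in -Real.pi..Real.pi, F (y + s • circleMap 0 1 θ)) r') r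
      = c * (r * ∫ θ in -Real.pi..Real.pi, planeLaplacian F (y + r • circleMap 0 1 θ)) := by
  have h1 : (fun r' : ℝ => r' * deriv (fun s : ℝ =>
        c * ∫ θ in -Real.pi..Real.pi, F (y + s • circleMap 0 1 θ)) r')
      = fun r' : ℝ => c * (r' * ∫ θ in -Real.pi..Real.pi,
        fderiv ℝ F (y + r' • circleMap 0 1 θ) (circleMap 0 1 θ)) := by
    ext r'
    rw [((hasDerivAt_circleMean hF y r').const_mul c).deriv]
    ring
  rw [h1]
  exact ((hasDerivAt_mul_circleMean_fderiv hF y r).const_mul c).deriv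

theorem stmt11
    (f : Esp 2 → ℝ) (hf : ContDiff ℝ (⊤ : ℕ∞) f)
    (hsupp : Function.support f ⊆ Metric.closedBall 0 1)
    (g : Esp 2 → ℝ → ℝ)
    (hg : ∀ y r, g y r = (1 / (2 * Real.pi)) * ∫ ω in unitSphere 2, f (y + r • ω) ∂(sphMeasure 2))
    (x : Esp 2) (hx : x ∈ Metric.ball (0 : Esp 2) 1) :
    f x = (1 / (2 * Real.pi)) * ∫ y in unitSphere 2,
      (∫ r in (0 : ℝ)..2,
        deriv (fun r' => r' * deriv (g y) r') r * Real.log |r ^ 2 - ‖x - y‖ ^ 2|)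
        ∂(sphMeasure 2) := by
  set e : ℂ ≃ₗᵢ[ℝ] Esp 2 := Complex.orthonormalBasisOneI.repr with he
  set F : ℂ → ℝ := fun z => f (e z) with hFd
  have hF : ContDiff ℝ (⊤ : ℕ∞) F := hf.comp e.contDiff
  have h0 : ∀ z, 1 < ‖z‖ → F z = 0 := by
    intro z hz
    by_contra hne
    have h1 := hsupp (show e z ∈ Function.support f from hne)
    rw [mem_closedBall_zero_iff, LinearIsometryEquiv.norm_map] at h1
    linarith
  have hx' : ‖e.symm x‖ < 1 := by
    rw [LinearIsometryEquiv.norm_map]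
    simpa using hx
  have hgF : ∀ φ : ℝ, g (circlePt φ) = fun r : ℝ => 1 / (2 * Real.pi) *
      ∫ θ in -Real.pi..Real.pi, F (circleMap 0 1 φ + r • circleMap 0 1 θ) := by
    intro φ
    ext r
    rw [hg, integral_unitSphere]
    simp only [hFd, map_add, map_smul]
    rfl
  have hnorm : ∀ φ : ℝ, ‖x - circlePt φ‖ = ‖e.symm x - circleMap 0 1 φ‖ := by
    intro φ
    rw [← LinearIsometryEquiv.norm_map e, map_sub, LinearIsometryEquiv.apply_symm_apply]
    rfl
  have hinv := circle_inversion hF h0 hx'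
  rw [integral_unitSphere]
  simp_rw [hgF, hnorm, deriv_mul_deriv_circleMean hF, mul_assoc (1 / (2 * Real.pi)),
    intervalIntegral.integral_const_mul]
  rw [hinv]
  have hfx : F (e.symm x) = f x := by simp [hFd]
  rw [hfx]
  have := Real.pi_ne_zero
  field_simp

end
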